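/- Let P_1, …, P_m be a Clifford system of signature (m, r) on ℝ^{2l}_s with m ≡ 0 (mod 4), r ≡ 0 (mod 2), and s ≤ 2l − 1, and set P := P_1P_2⋯P_m. Assume one of the following three cases holds: (d-1) r = 0 and s < 2(l − m); (d-2) r ∈ {2, 4, …, m−2}, s = l, and m − r < l/2; (d-3) r = m, s = l, and the index s₁ of the restriction of ⟨·,·⟩ to E_+(P) satisfies m ≤ s₁ ≤ l − m. Then M_+ is connected, and M_{+,1}, M_{+,2}, M_{+,3} are all non-empty. -/

import Mathlib

open Matrix

noncomputable section

/-- Entries of the signature matrix `J_{r,m-r}`, with 1-based indices: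
`η_{ii} = -1` for `1 ≤ i ≤ r` and `η_{ii} = 1` for `r < i`; off-diagonal entries vanish. -/
def cliffEta (r i j : ℕ) : ℝ :=
  if i = j then (if i ≤ r then -1 else 1) else 0

/-- The matrix `J_{s,n-s} = diag(-E_s, E_{n-s})`. -/
def psJ (n s : ℕ) : Matrix (Fin n) (Fin n) ℝ :=
  Matrix.diagonal fun i => if (i : ℕ) < s then (-1 : ℝ) else 1

/-- The pseudo-inner product `⟨u, v⟩ = uᵀ J_{s,n-s} v` of `ℝ^n_s`. -/
def psInner (n s : ℕ) (u v : Fin n → ℝ) : ℝ :=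
  u ⬝ᵥ ((psJ n s) *ᵥ v)

/-- A Clifford system of signature `(m, r)` on `ℝ^{2l}_s`, indexed by `1, …, m`:
each `P i` is symmetric with respect to the pseudo-inner product, and
`P i * P j + P j * P i = 2 η_{ij} E_{2l}`. -/
def IsCliffordSystem (l s m r : ℕ)
    (P : ℕ → Matrix (Fin (2 * l)) (Fin (2 * l)) ℝ) : Prop :=
  (∀ i ∈ Finset.Icc 1 m, (P i)ᵀ = psJ (2 * l) s * P i * psJ (2 * l) s) ∧
  (∀ i ∈ Finset.Icc 1 m, ∀ j ∈ Finset.Icc 1 m,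
    P i * P j + P j * P i
      = (2 * cliffEta r i j) • (1 : Matrix (Fin (2 * l)) (Fin (2 * l)) ℝ))

/-- The index of the restriction of the pseudo-inner product of `ℝ^n_s` to a subspace
`V`: the supremum of dimensions of subspaces of `V` on which `⟨·,·⟩` is negative
definite. -/
noncomputable def negIndex (n s : ℕ) (V : Submodule ℝ (Fin n → ℝ)) : ℕ :=
  sSup {d : ℕ | ∃ W : Submodule ℝ (Fin n → ℝ), W ≤ V ∧
    (∀ z ∈ W, z ≠ 0 → psInner n s z z < 0) ∧ Module.finrank ℝ ↥W = d}



section PseudoEuclid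

variable {n : ℕ} (B : LinearMap.BilinForm ℝ (Fin n → ℝ))

/-- positive definite on a subspace -/
def PosOn (W : Submodule ℝ (Fin n → ℝ)) : Prop := ∀ w ∈ W, w ≠ 0 → 0 < B w w

variable {B}

theorem expand_sq (hB : ∀ x y, B x y = B y x) (a u : Fin n → ℝ) (α t : ℝ) :
    B (α • a + t • u) (α • a + t • u) = α ^ 2 * B a a + 2 * α * t * B a u + t ^ 2 * B u u := by
  simp only [map_add, map_smul, LinearMap.add_apply, LinearMap.smul_apply, smul_eq_mul, hB u a]
  ring

theorem exists_max_pos (hB : ∀ x y, B x y = B y x) (E : Submodule ℝ (Fin n → ℝ)) :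
    ∃ W ≤ E, PosOn B W ∧ ∀ z ∈ E, (∀ w ∈ W, B w z = 0) → B z z ≤ 0 := by
  obtain ⟨W, ⟨hWE, hW⟩, hmax⟩ := (wellFounded_gt (α := Submodule ℝ (Fin n → ℝ))).has_min
    {W | W ≤ E ∧ PosOn B W} ⟨⊥, bot_le, fun w hw h => absurd (by simpa using hw) h⟩
  refine ⟨W, hWE, hW, fun z hz hort => ?_⟩
  by_contra hpos
  push Not at hpos
  have hmem : W ⊔ Submodule.span ℝ {z} ∈ {W | W ≤ E ∧ PosOn B W} := by
    refine ⟨sup_le hWE (by simpa using hz), fun w hw hne => ?_⟩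
    obtain ⟨a, ha, b, hb, rfl⟩ := Submodule.mem_sup.1 hw
    obtain ⟨c, rfl⟩ := Submodule.mem_span_singleton.1 hb
    have := expand_sq hB a z 1 c
    simp only [one_smul, hort a ha] at this
    rw [this]
    by_cases h0 : a = 0
    · have hc : c ≠ 0 := by rintro rfl; simp [h0] at hne
      have : 0 < c ^ 2 := by positivity
      simp [h0]; positivity
    · have := hW a ha h0
      have : 0 ≤ c ^ 2 * B z z := by positivity
      linarith
  have h1 := hmax _ hmem
  have hle : W ⊔ Submodule.span ℝ {z} ≤ W := by
    by_contra h
    exact h1 (lt_of_le_not_ge le_sup_left h)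
  have hzW : z ∈ W := hle (Submodule.mem_sup_right (Submodule.mem_span_singleton_self z))
  have := hort z hzW
  linarith

theorem join_aux (hB : ∀ x y, B x y = B y x) {S : Set (Fin n → ℝ)} {a u : Fin n → ℝ} {c : ℝ}
    (ha : B a a = 1) (hau : B a u = 0) (hc : 0 ≤ c) (hz : B (c • a + u) (c • a + u) = 1)
    (hS : ∀ α t : ℝ, B (α • a + t • u) (α • a + t • u) = 1 → α • a + t • u ∈ S) :
    JoinedIn S a (c • a + u) := by
  have e := expand_sq hB a u c 1
  simp only [one_smul, ha, hau] at e
  have hu : B u u = 1 - c ^ 2 := by linarith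
  have hnn : ∀ t ∈ unitInterval, 0 ≤ 1 - t ^ 2 * B u u := by
    rintro t ⟨h0, h1⟩
    rw [hu]
    nlinarith [mul_nonneg (sq_nonneg t) (sq_nonneg c), mul_nonneg h0 (sub_nonneg.2 h1)]
  refine JoinedIn.ofLine (f := fun t => Real.sqrt (1 - t ^ 2 * B u u) • a + t • u) ?_ ?_ ?_ ?_
  · fun_prop
  · simp
  · simp [hu, Real.sqrt_sq hc]
  · rintro _ ⟨t, ht, rfl⟩
    apply hS
    rw [expand_sq hB, ha, hau, Real.sq_sqrt (hnn t ht)]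
    ring

theorem PosOn.normalize {W : Submodule ℝ (Fin n → ℝ)} (hW : PosOn B W) {w : Fin n → ℝ}
    (hw : w ∈ W) (h0 : w ≠ 0) :
    ∃ a ∈ W, B a a = 1 ∧ w = Real.sqrt (B w w) • a := by
  have hp := hW w hw h0
  have hs := Real.sqrt_pos.2 hp
  refine ⟨(Real.sqrt (B w w))⁻¹ • w, W.smul_mem _ hw, ?_, ?_⟩
  · simp only [map_smul, LinearMap.smul_apply, smul_eq_mul]
    field_simp
    rw [Real.sq_sqrt hp.le]
  · rw [smul_smul, mul_inv_cancel₀ hs.ne', one_smul]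

theorem PosOn.exists_ne {W : Submodule ℝ (Fin n → ℝ)} 
    (h2 : 2 ≤ Module.finrank ℝ W) : ∃ a ∈ W, a ≠ 0 := by
  have : W ≠ ⊥ := by rintro rfl; simp at h2
  exact Submodule.exists_mem_ne_zero_of_ne_bot this

theorem sphere_small {W : Submodule ℝ (Fin n → ℝ)} (hW : PosOn B W)
    (h2 : 2 ≤ Module.finrank ℝ W) : IsPathConnected {x | x ∈ W ∧ B x x = 1} := by
  have hr : 1 < Module.rank ℝ W := by
    rw [← Module.finrank_eq_rank]
    exact_mod_cast h2
  have h1 := isPathConnected_compl_singleton_of_one_lt_rank hr (0 : W)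
  have hcont : Continuous fun x : W => B (x : Fin n → ℝ) (x : Fin n → ℝ) := by
    have : Continuous fun x : (Fin n → ℝ) => B x x := by
      have h : (fun x : (Fin n → ℝ) => B x x) = fun x => B.toMatrix₂' ℝ |>.toLinearMap₂' ℝ |> fun C => C x x := by
        simp
      rw [h]
      simp only [Matrix.toLinearMap₂'_apply]
      fun_prop
    exact this.comp continuous_subtype_val
  have h3 := h1.image' (f := fun x : W => (Real.sqrt (B (x : Fin n → ℝ) x))⁻¹ • (x : Fin n → ℝ)) (by
    refine ContinuousOn.smul (ContinuousOn.inv₀ (Real.continuous_sqrt.comp hcont).continuousOn ?_)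
      continuous_subtype_val.continuousOn
    intro x hx
    exact (Real.sqrt_pos.2 (hW x x.2 (by simpa using hx))).ne')
  convert h3 using 1
  ext x
  constructor
  · rintro ⟨hx, h⟩
    refine ⟨⟨x, hx⟩, ?_, by simp [h]⟩
    simp only [Set.mem_compl_iff, Set.mem_singleton_iff, Submodule.mk_eq_zero]
    rintro rfl
    simp at h
  · rintro ⟨⟨w, hw⟩, h0, rfl⟩
    have h0' : w ≠ 0 := by simpa using h0
    have hp := hW w hw h0'
    have hs := Real.sqrt_pos.2 hp
    refine ⟨W.smul_mem _ hw, ?_⟩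
    simp only [map_smul, LinearMap.smul_apply, smul_eq_mul]
    field_simp
    rw [Real.sq_sqrt hp.le]

theorem proj_pos (hB : ∀ x y, B x y = B y x) {W : Submodule ℝ (Fin n → ℝ)} (hW : PosOn B W)
    (x : Fin n → ℝ) : ∃ w ∈ W, ∀ v ∈ W, B v (x - w) = 0 := by
  have hd : Disjoint W (B.orthogonal W) := by
    rw [Submodule.disjoint_def]
    intro w hw ho
    by_contra h0
    have := hW w hw h0
    rw [LinearMap.BilinForm.mem_orthogonal_iff] at ho
    have h := ho w hw
    linarith
  have hrefl : B.IsRefl := fun x y h => by rw [hB]; exact h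
  have hc := LinearMap.BilinForm.finrank_add_finrank_orthogonal hrefl W
  have htop : W ⊔ B.orthogonal W = ⊤ := by
    apply Submodule.eq_top_of_disjoint _ _ _ hd
    omega
  have hx : x ∈ W ⊔ B.orthogonal W := htop ▸ Submodule.mem_top
  obtain ⟨w, hw, u, hu, rfl⟩ := Submodule.mem_sup.1 hx
  refine ⟨w, hw, fun v hv => ?_⟩
  rw [LinearMap.BilinForm.mem_orthogonal_iff] at hu
  simpa using hu v hv

theorem sphere_conn (hB : ∀ x y, B x y = B y x) {E W : Submodule ℝ (Fin n → ℝ)} (hWE : W ≤ E)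
    (hW : PosOn B W) (h2 : 2 ≤ Module.finrank ℝ W) :
    IsPathConnected {x | x ∈ E ∧ B x x = 1} := by
  have hs := sphere_small hW h2
  obtain ⟨e, he, he0⟩ := PosOn.exists_ne h2
  obtain ⟨a0, ha0, ha01, -⟩ := hW.normalize he he0
  refine ⟨a0, ⟨hWE ha0, ha01⟩, ?_⟩
  rintro x ⟨hxE, hx1⟩
  obtain ⟨w, hw, hort⟩ := proj_pos hB hW x
  obtain ⟨a, ha, ha1, c, hc, hwa⟩ : ∃ a ∈ W, B a a = 1 ∧ ∃ c : ℝ, 0 ≤ c ∧ w = c • a := by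
    by_cases h0 : w = 0
    · exact ⟨a0, ha0, ha01, 0, le_rfl, by simp [h0]⟩
    · obtain ⟨a, ha, ha1, h⟩ := hW.normalize hw h0
      exact ⟨a, ha, ha1, _, Real.sqrt_nonneg _, h⟩
  have hj : JoinedIn {x | x ∈ E ∧ B x x = 1} a0 a :=
    (hs.joinedIn a0 ⟨ha0, ha01⟩ a ⟨ha, ha1⟩).mono fun y hy => ⟨hWE hy.1, hy.2⟩
  have hxe : c • a + (x - w) = x := by rw [hwa]; abel
  have hj2 : JoinedIn {x | x ∈ E ∧ B x x = 1} a (c • a + (x - w)) := by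
    apply join_aux hB ha1 (hort a ha) hc
    · rw [hxe, hx1]
    · intro α t h
      exact ⟨E.add_mem (E.smul_mem _ (hWE ha)) (E.smul_mem _ (E.sub_mem hxE (hWE hw))), h⟩
  rw [hxe] at hj2
  exact hj.trans hj2

/-- Dimension count for a splitting into two orthogonal subspaces. -/
theorem split_dim (hB : ∀ x y, B x y = B y x) {E F Q : Submodule ℝ (Fin n → ℝ)}
    (hEF : ∀ x ∈ E, ∀ y ∈ F, B x y = 0) (hdec : ∀ z, ∃ x ∈ E, ∃ y ∈ F, z = x + y)
    (hQ : PosOn B Q) :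
    ∃ W₁ ≤ E, ∃ W₂ ≤ F, PosOn B W₁ ∧ PosOn B W₂ ∧
      Module.finrank ℝ Q ≤ Module.finrank ℝ W₁ + Module.finrank ℝ W₂ := by
  obtain ⟨W₁, hE1, hp1, hm1⟩ := exists_max_pos hB E
  obtain ⟨W₂, hF2, hp2, hm2⟩ := exists_max_pos hB F
  refine ⟨W₁, hE1, W₂, hF2, hp1, hp2, ?_⟩
  have hrefl : B.IsRefl := fun x y h => by rw [hB]; exact h
  have hc := LinearMap.BilinForm.finrank_add_finrank_orthogonal hrefl (W₁ ⊔ W₂)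
  have hle := Submodule.finrank_add_le_finrank_add_finrank W₁ W₂
  have hd : Disjoint Q (B.orthogonal (W₁ ⊔ W₂)) := by
    rw [Submodule.disjoint_def]
    intro z hz ho
    by_contra h0
    have hpos := hQ z hz h0
    rw [LinearMap.BilinForm.mem_orthogonal_iff] at ho
    obtain ⟨x, hx, y, hy, rfl⟩ := hdec z
    have h1 : B x x ≤ 0 := by
      apply hm1 x hx
      intro w hw
      have h : B w (x + y) = 0 := ho w (Submodule.mem_sup_left hw)
      rw [map_add, hEF w (hE1 hw) y hy, add_zero] at h
      exact h
    have h2 : B y y ≤ 0 := by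
      apply hm2 y hy
      intro w hw
      have h : B w (x + y) = 0 := ho w (Submodule.mem_sup_right hw)
      rw [map_add, hB w x, hEF x hx w (hF2 hw), zero_add] at h
      exact h
    have := expand_sq hB x y 1 1
    simp only [one_smul, hEF x hx y hy] at this
    linarith
  have h3 := Submodule.finrank_add_finrank_le_of_disjoint hd
  omega

/-- A positive vector orthogonal to all `L j x`. -/
theorem exists_orth (hB : ∀ x y, B x y = B y x) {F W : Submodule ℝ (Fin n → ℝ)} (hWF : W ≤ F)
    (hW : PosOn B W) (m r : ℕ) (hr : r ≤ m) (hdim : m - r < Module.finrank ℝ W)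
    (v : ℕ → Fin n → ℝ) (hv : ∀ j ∈ Finset.Icc 1 m, v j ∈ F)
    (hvv : ∀ i ∈ Finset.Icc 1 m, ∀ j ∈ Finset.Icc 1 m, B (v i) (v j) = cliffEta r i j) :
    ∃ y ∈ F, B y y = 1 ∧ ∀ j ∈ Finset.Icc 1 m, B (v j) y = 0 := by
  let f : W →ₗ[ℝ] (Fin (m - r) → ℝ) :=
    LinearMap.pi fun k => (B (v (r + 1 + k))).comp W.subtype
  have hker := LinearMap.ker_ne_bot_of_finrank_lt (f := f) (by simpa using hdim)
  obtain ⟨⟨w, hw⟩, hk, hne⟩ := Submodule.exists_mem_ne_zero_of_ne_bot hker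
  have hw0 : w ≠ 0 := by simpa using hne
  have hwp := hW w hw hw0
  have hk' : ∀ j ∈ Finset.Icc 1 m, r < j → B (v j) w = 0 := by
    intro j hj hrj
    rw [Finset.mem_Icc] at hj
    have h := congrFun (LinearMap.mem_ker.1 hk) ⟨j - (r + 1), by omega⟩
    simp only [f, LinearMap.pi_apply, LinearMap.comp_apply, Submodule.subtype_apply,
      Pi.zero_apply] at h
    rwa [show r + 1 + (j - (r + 1)) = j by omega] at h
  set q : Fin n → ℝ := ∑ j ∈ Finset.Icc 1 r, B (v j) w • v j with hq
  have hqF : q ∈ F := F.sum_mem fun j hj => F.smul_mem _ (hv j (by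
    rw [Finset.mem_Icc] at hj ⊢; omega))
  have hvq : ∀ i ∈ Finset.Icc 1 m, B (v i) q = - B (v i) w := by
    intro i hi
    have : B (v i) q = ∑ j ∈ Finset.Icc 1 r, B (v j) w * cliffEta r i j := by
      rw [hq, map_sum]
      refine Finset.sum_congr rfl fun j hj => ?_
      rw [map_smul, smul_eq_mul, hvv i hi j (by rw [Finset.mem_Icc] at hj ⊢; omega)]
    rw [this]
    by_cases hir : i ≤ r
    · rw [Finset.mem_Icc] at hi
      rw [Finset.sum_eq_single i]
      · simp [cliffEta, hir]
      · intro j _ hji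
        simp [cliffEta, Ne.symm hji]
      · intro h
        exact absurd (Finset.mem_Icc.2 ⟨hi.1, hir⟩) h
    · rw [hk' i hi (by omega), neg_zero]
      refine Finset.sum_eq_zero fun j hj => ?_
      rw [Finset.mem_Icc] at hj
      have : i ≠ j := by omega
      simp [cliffEta, this]
  have hy0 : ∀ j ∈ Finset.Icc 1 m, B (v j) (w + q) = 0 := by
    intro j hj
    rw [map_add, hvq j hj]; ring
  have hqy : B q (w + q) = 0 := by
    conv_lhs => rw [hq]
    rw [map_sum, LinearMap.sum_apply]
    refine Finset.sum_eq_zero fun j hj => ?_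
    rw [map_smul, LinearMap.smul_apply]
    rw [← hq, hy0 j (by rw [Finset.mem_Icc] at hj ⊢; omega), smul_zero]
  have hwq : B w q = ∑ j ∈ Finset.Icc 1 r, B (v j) w ^ 2 := by
    rw [hq, map_sum]
    refine Finset.sum_congr rfl fun j hj => ?_
    rw [map_smul, smul_eq_mul, hB w]; ring
  have hpos : 0 < B (w + q) (w + q) := by
    have h1 : B (w + q) (w + q) = B w w + B w q := by
      rw [map_add B w q, LinearMap.add_apply, hqy, map_add]; ring
    have h2 : 0 ≤ B w q := by rw [hwq]; positivity
    linarith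
  refine ⟨(Real.sqrt (B (w + q) (w + q)))⁻¹ • (w + q),
    F.smul_mem _ (F.add_mem (hWF hw) hqF), ?_, ?_⟩
  · have hs := Real.sqrt_pos.2 hpos
    generalize w + q = y at *
    simp only [map_smul, LinearMap.smul_apply, smul_eq_mul]
    field_simp
    rw [Real.sq_sqrt hpos.le]
  · intro j hj
    rw [map_smul, hy0 j hj, smul_zero]

theorem core_thm (hB : ∀ x y, B x y = B y x) (m r : ℕ) (hr : r ≤ m)
    (L : ℕ → (Fin n → ℝ) →ₗ[ℝ] (Fin n → ℝ)) {E F W₁ W₂ : Submodule ℝ (Fin n → ℝ)}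
    (hEF : ∀ x ∈ E, ∀ y ∈ F, B x y = 0) (hdec : ∀ z, ∃ x ∈ E, ∃ y ∈ F, z = x + y)
    (hLB : ∀ j ∈ Finset.Icc 1 m, ∀ x y, B (L j x) y = B x (L j y))
    (hLE : ∀ j ∈ Finset.Icc 1 m, ∀ x ∈ E, L j x ∈ F)
    (hLF : ∀ j ∈ Finset.Icc 1 m, ∀ x ∈ F, L j x ∈ E)
    (hLL : ∀ i ∈ Finset.Icc 1 m, ∀ j ∈ Finset.Icc 1 m, ∀ x,
      B (L i x) (L j x) = cliffEta r i j * B x x)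
    (h1E : W₁ ≤ E) (h2F : W₂ ≤ F) (hp1 : PosOn B W₁) (hp2 : PosOn B W₂)
    (hd1 : 2 ≤ Module.finrank ℝ W₁) (hd2 : 2 ≤ Module.finrank ℝ W₂)
    (hd : m - r < Module.finrank ℝ W₂)
    (Mp : Set (Fin n → ℝ))
    (hMp : Mp = {x | B x x = 1 ∧ ∀ j ∈ Finset.Icc 1 m, B (L j x) x = 0}) :
    IsConnected Mp ∧ ∃ x ∈ E, ∃ y ∈ F, B x x = 1 ∧ B y y = 1 ∧ x ∈ Mp ∧ y ∈ Mp ∧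
      (Real.sqrt 2)⁻¹ • x + (Real.sqrt 2)⁻¹ • y ∈ Mp := by
  have hmem : ∀ x ∈ E, ∀ y ∈ F, B x x + B y y = 1 →
      (∀ j ∈ Finset.Icc 1 m, B (L j x) y = 0) → x + y ∈ Mp := by
    intro x hx y hy h1 h2
    rw [hMp]
    refine ⟨?_, fun j hj => ?_⟩
    · have := expand_sq hB x y 1 1
      simp only [one_smul, hEF x hx y hy] at this
      linarith
    · simp only [map_add, LinearMap.add_apply]
      rw [hB (L j x) x, hEF x hx _ (hLE j hj x hx), hEF _ (hLF j hj y hy) y hy, h2 j hj,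
        hLB j hj y x, hB y, h2 j hj]
      ring
  have hmem' : ∀ x ∈ E, ∀ y ∈ F, x + y ∈ Mp → B x x + B y y = 1 ∧
      (∀ j ∈ Finset.Icc 1 m, B (L j x) y = 0) := by
    intro x hx y hy h
    rw [hMp] at h
    obtain ⟨h1, h2⟩ := h
    refine ⟨?_, fun j hj => ?_⟩
    · have := expand_sq hB x y 1 1
      simp only [one_smul, hEF x hx y hy] at this
      linarith
    · have h := h2 j hj
      simp only [map_add, LinearMap.add_apply] at h
      rw [hB (L j x) x, hEF x hx _ (hLE j hj x hx), hEF _ (hLF j hj y hy) y hy,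
        hLB j hj y x, hB y] at h
      linarith
  have hSE : {x | x ∈ E ∧ B x x = 1} ⊆ Mp := by
    rintro x ⟨hx, h⟩
    have := hmem x hx 0 F.zero_mem (by simpa using h) (by simp)
    simpa using this
  have hSF : {x | x ∈ F ∧ B x x = 1} ⊆ Mp := by
    rintro x ⟨hx, h⟩
    have := hmem 0 E.zero_mem x hx (by simpa using h) (by simp)
    simpa using this
  have hcE := sphere_conn hB h1E hp1 hd1
  have hcF := sphere_conn hB h2F hp2 hd2
  obtain ⟨e, he, he0⟩ := PosOn.exists_ne hd1
  obtain ⟨x0, hx0, hx1, -⟩ := hp1.normalize he he0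
  have hx0E := h1E hx0
  obtain ⟨y0, hy0, hy1, hxy⟩ := exists_orth hB h2F hp2 m r hr hd (fun j => L j x0)
    (fun j hj => hLE j hj x0 hx0E) (fun i hi j hj => by rw [hLL i hi j hj, hx1, mul_one])
  have hs2 : (0 : ℝ) < Real.sqrt 2 := by positivity
  have hs2' : ((Real.sqrt 2)⁻¹ : ℝ) ^ 2 = 1 / 2 := by
    rw [inv_pow, Real.sq_sqrt (by norm_num)]; norm_num
  have hz3 : (Real.sqrt 2)⁻¹ • x0 + (Real.sqrt 2)⁻¹ • y0 ∈ Mp := by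
    apply hmem _ (E.smul_mem _ hx0E) _ (F.smul_mem _ hy0)
    · simp only [map_smul, LinearMap.smul_apply, smul_eq_mul, hx1, hy1]
      nlinarith
    · intro j hj
      simp only [map_smul, LinearMap.smul_apply, smul_eq_mul, hxy j hj]
      ring
  -- joining to the two spheres
  have hjE : ∀ x ∈ E, ∀ y ∈ F, x + y ∈ Mp → 0 < B x x →
      ∃ a ∈ E, B a a = 1 ∧ JoinedIn Mp a (x + y) := by
    intro x hx y hy hz hpos
    obtain ⟨h1, h2⟩ := hmem' x hx y hy hz
    have hs := Real.sqrt_pos.2 hpos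
    have haa : B ((Real.sqrt (B x x))⁻¹ • x) ((Real.sqrt (B x x))⁻¹ • x) = 1 := by
      simp only [map_smul, LinearMap.smul_apply, smul_eq_mul]
      field_simp
      rw [Real.sq_sqrt hpos.le]
    refine ⟨(Real.sqrt (B x x))⁻¹ • x, E.smul_mem _ hx, haa, ?_⟩
    have hxe : Real.sqrt (B x x) • ((Real.sqrt (B x x))⁻¹ • x) = x := by
      rw [smul_smul, mul_inv_cancel₀ hs.ne', one_smul]
    have := join_aux (S := Mp) hB haa (u := y) (c := Real.sqrt (B x x))
      (hEF _ (E.smul_mem _ hx) y hy) hs.le (by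
        rw [hxe]; rw [hMp] at hz; exact hz.1) (by
        intro α t h
        have ho := hEF _ (E.smul_mem (Real.sqrt (B x x))⁻¹ hx) y hy
        apply hmem _ (E.smul_mem _ (E.smul_mem _ hx)) _ (F.smul_mem _ hy)
        · rw [expand_sq hB, ho] at h
          generalize (Real.sqrt (B x x))⁻¹ • x = a at *
          simp only [map_smul, LinearMap.smul_apply, smul_eq_mul]
          linarith
        · intro j hj
          simp only [map_smul, LinearMap.smul_apply, smul_eq_mul, h2 j hj]
          ring)
    rwa [hxe] at this
  have hjF : ∀ x ∈ E, ∀ y ∈ F, x + y ∈ Mp → 0 < B y y →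
      ∃ a ∈ F, B a a = 1 ∧ JoinedIn Mp a (x + y) := by
    intro x hx y hy hz hpos
    obtain ⟨h1, h2⟩ := hmem' x hx y hy hz
    have hs := Real.sqrt_pos.2 hpos
    have haa : B ((Real.sqrt (B y y))⁻¹ • y) ((Real.sqrt (B y y))⁻¹ • y) = 1 := by
      simp only [map_smul, LinearMap.smul_apply, smul_eq_mul]
      field_simp
      rw [Real.sq_sqrt hpos.le]
    refine ⟨(Real.sqrt (B y y))⁻¹ • y, F.smul_mem _ hy, haa, ?_⟩
    have hxe : Real.sqrt (B y y) • ((Real.sqrt (B y y))⁻¹ • y) = y := by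
      rw [smul_smul, mul_inv_cancel₀ hs.ne', one_smul]
    have := join_aux (S := Mp) hB haa (u := x) (c := Real.sqrt (B y y))
      (by rw [hB]; exact hEF x hx _ (F.smul_mem _ hy)) hs.le (by
        rw [hxe, add_comm]; rw [hMp] at hz; exact hz.1) (by
        intro α t h
        have ho : B ((Real.sqrt (B y y))⁻¹ • y) x = 0 := by
          rw [hB]; exact hEF x hx _ (F.smul_mem _ hy)
        rw [add_comm]
        apply hmem _ (E.smul_mem _ hx) _ (F.smul_mem _ (F.smul_mem _ hy))
        · rw [expand_sq hB, ho] at h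
          generalize (Real.sqrt (B y y))⁻¹ • y = a at *
          simp only [map_smul, LinearMap.smul_apply, smul_eq_mul]
          linarith
        · intro j hj
          simp only [map_smul, LinearMap.smul_apply, smul_eq_mul, h2 j hj]
          ring)
    rwa [hxe, add_comm] at this
  have hE0 : ∀ a ∈ E, B a a = 1 → JoinedIn Mp x0 a := fun a ha h =>
    (hcE.joinedIn x0 ⟨hx0E, hx1⟩ a ⟨ha, h⟩).mono hSE
  have hF0 : ∀ a ∈ F, B a a = 1 → JoinedIn Mp y0 a := fun a ha h =>
    (hcF.joinedIn y0 ⟨hy0, hy1⟩ a ⟨ha, h⟩).mono hSF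
  have hxy0 : JoinedIn Mp x0 y0 := by
    have p1 : 0 < B ((Real.sqrt 2)⁻¹ • x0) ((Real.sqrt 2)⁻¹ • x0) := by
      simp only [map_smul, LinearMap.smul_apply, smul_eq_mul, hx1]; positivity
    have p2 : 0 < B ((Real.sqrt 2)⁻¹ • y0) ((Real.sqrt 2)⁻¹ • y0) := by
      simp only [map_smul, LinearMap.smul_apply, smul_eq_mul, hy1]; positivity
    obtain ⟨a, ha, ha1, hja⟩ := hjE _ (E.smul_mem _ hx0E) _ (F.smul_mem _ hy0) hz3 p1
    obtain ⟨b, hb, hb1, hjb⟩ := hjF _ (E.smul_mem _ hx0E) _ (F.smul_mem _ hy0) hz3 p2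
    exact ((hE0 a ha ha1).trans hja).trans ((hF0 b hb hb1).trans hjb).symm
  refine ⟨?_, x0, hx0E, y0, hy0, hx1, hy1, hSE ⟨hx0E, hx1⟩, hSF ⟨hy0, hy1⟩, hz3⟩
  have : IsPathConnected Mp := by
    refine ⟨x0, hSE ⟨hx0E, hx1⟩, fun {z} hz => ?_⟩
    obtain ⟨x, hx, y, hy, rfl⟩ := hdec z
    by_cases hpos : 0 < B x x
    · obtain ⟨a, ha, ha1, hja⟩ := hjE x hx y hy hz hpos
      exact (hE0 a ha ha1).trans hja
    · have := (hmem' x hx y hy hz).1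
      obtain ⟨b, hb, hb1, hjb⟩ := hjF x hx y hy hz (by linarith)
      exact hxy0.trans ((hF0 b hb hb1).trans hjb)
  exact this.isConnected

end PseudoEuclid

section CliffordProd

variable {l s m r : ℕ} {P : ℕ → Matrix (Fin (2 * l)) (Fin (2 * l)) ℝ}

/-- partial products -/
def cliffProd (P : ℕ → Matrix (Fin (2 * l)) (Fin (2 * l)) ℝ) (k : ℕ) :
    Matrix (Fin (2 * l)) (Fin (2 * l)) ℝ := ((List.range k).map fun k => P (1 + k)).prod

theorem cliffProd_succ (k : ℕ) : cliffProd P (k + 1) = cliffProd P k * P (k + 1) := by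
  simp [cliffProd, List.range_succ, add_comm]

theorem psJ_sq (n s : ℕ) : psJ n s * psJ n s = 1 := by
  rw [psJ, Matrix.diagonal_mul_diagonal, ← Matrix.diagonal_one]
  congr 1
  ext i
  split_ifs <;> norm_num

theorem psJ_tr (n s : ℕ) : (psJ n s)ᵀ = psJ n s := by
  simp [psJ]

theorem cliff_anti (hP : IsCliffordSystem l s m r P) {i j : ℕ} (hi : i ∈ Finset.Icc 1 m)
    (hj : j ∈ Finset.Icc 1 m) (hij : i ≠ j) : P i * P j = - (P j * P i) := by
  have := hP.2 i hi j hj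
  simp only [cliffEta, hij, if_false, mul_zero, zero_smul] at this
  exact eq_neg_of_add_eq_zero_left this

theorem cliff_sq (hP : IsCliffordSystem l s m r P) {i : ℕ} (hi : i ∈ Finset.Icc 1 m) :
    P i * P i = cliffEta r i i • (1 : Matrix (Fin (2 * l)) (Fin (2 * l)) ℝ) := by
  have := hP.2 i hi i hi
  rw [← two_smul ℝ, mul_smul] at this
  exact smul_right_injective _ (two_ne_zero (α := ℝ)) this

theorem cliffProd_comm_out (hP : IsCliffordSystem l s m r P) {j : ℕ} (hj : j ∈ Finset.Icc 1 m)
    (k : ℕ) (hk : k < j) : P j * cliffProd P k = ((-1 : ℝ) ^ k) • (cliffProd P k * P j) := by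
  induction k with
  | zero => simp [cliffProd]
  | succ k ih =>
    have hk1 : k + 1 ∈ Finset.Icc 1 m := by rw [Finset.mem_Icc] at hj ⊢; omega
    rw [cliffProd_succ, ← mul_assoc, ih (by omega), smul_mul_assoc, mul_assoc,
      cliff_anti hP hj hk1 (by omega), pow_succ, mul_neg, smul_neg, mul_assoc]
    simp

theorem cliffProd_comm_in (hP : IsCliffordSystem l s m r P) {j : ℕ} (hj : j ∈ Finset.Icc 1 m)
    (k : ℕ) (hk : j ≤ k) (hkm : k ≤ m) :
    P j * cliffProd P k = (-(-1 : ℝ) ^ k) • (cliffProd P k * P j) := by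
  induction k, hk using Nat.le_induction with
  | base =>
    obtain ⟨i, rfl⟩ : ∃ i, j = i + 1 := ⟨j - 1, by rw [Finset.mem_Icc] at hj; omega⟩
    rw [cliffProd_succ, ← mul_assoc, cliffProd_comm_out hP hj i (by omega), smul_mul_assoc,
      pow_succ]
    simp
  | succ k hk ih =>
    have hk1 : k + 1 ∈ Finset.Icc 1 m := by rw [Finset.mem_Icc] at hj ⊢; omega
    rw [cliffProd_succ, ← mul_assoc, ih (by omega), smul_mul_assoc, mul_assoc,
      cliff_anti hP hj hk1 (by omega), pow_succ, mul_neg, smul_neg, mul_assoc]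
    simp

theorem cliffProd_sq (hP : IsCliffordSystem l s m r P) (k : ℕ) (hk : k ≤ m) :
    cliffProd P k * cliffProd P k
      = ((-1 : ℝ) ^ (k.choose 2 + min k r)) • (1 : Matrix (Fin (2 * l)) (Fin (2 * l)) ℝ) := by
  induction k with
  | zero => simp [cliffProd]
  | succ k ih =>
    have hk1 : k + 1 ∈ Finset.Icc 1 m := by rw [Finset.mem_Icc]; omega
    have e1 : cliffProd P k * P (k + 1) * (cliffProd P k * P (k + 1))
        = cliffProd P k * (P (k + 1) * cliffProd P k) * P (k + 1) := by
      simp only [mul_assoc]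
    rw [cliffProd_succ, e1, cliffProd_comm_out hP hk1 k (by omega), mul_smul_comm,
      smul_mul_assoc, ← mul_assoc, ih (by omega), mul_assoc, cliff_sq hP hk1]
    have e2 : (k + 1).choose 2 = k + k.choose 2 := by
      rw [Nat.choose_succ_succ' k 1, Nat.choose_one_right]
    rw [e2, smul_mul_assoc, one_mul, smul_smul, smul_smul]
    congr 1
    by_cases h : k + 1 ≤ r
    · rw [min_eq_left h, min_eq_left (by omega : k ≤ r)]
      simp only [cliffEta, if_true, h]
      ring
    · rw [min_eq_right (by omega), min_eq_right (by omega)]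
      simp only [cliffEta, if_true, h, if_false]
      ring

theorem cliffProd_tr (hP : IsCliffordSystem l s m r P) (k : ℕ) (hk : k ≤ m) :
    (cliffProd P k)ᵀ
      = ((-1 : ℝ) ^ (k.choose 2)) • (psJ (2 * l) s * cliffProd P k * psJ (2 * l) s) := by
  induction k with
  | zero => simp [cliffProd, psJ_sq]
  | succ k ih =>
    have hk1 : k + 1 ∈ Finset.Icc 1 m := by rw [Finset.mem_Icc]; omega
    have e2 : (k + 1).choose 2 = k + k.choose 2 := by
      rw [Nat.choose_succ_succ' k 1, Nat.choose_one_right]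
    have e1 : psJ (2 * l) s * P (k + 1) * psJ (2 * l) s *
        (psJ (2 * l) s * cliffProd P k * psJ (2 * l) s)
        = psJ (2 * l) s * (P (k + 1) * cliffProd P k) * psJ (2 * l) s := by
      calc _ = psJ (2 * l) s * P (k + 1) * (psJ (2 * l) s *
        psJ (2 * l) s) * cliffProd P k * psJ (2 * l) s := by simp only [mul_assoc]
        _ = _ := by rw [psJ_sq]; simp only [mul_assoc, one_mul]
    rw [cliffProd_succ, Matrix.transpose_mul, hP.1 _ hk1, ih (by omega), mul_smul_comm, e1,
      cliffProd_comm_out hP hk1 k (by omega), e2, mul_smul_comm, smul_mul_assoc, smul_smul]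
    congr 1
    ring

/-- the bilinear form -/
def psB (n s : ℕ) : LinearMap.BilinForm ℝ (Fin n → ℝ) := Matrix.toBilin' (psJ n s)

theorem psB_apply (n s : ℕ) (x y : Fin n → ℝ) : psB n s x y = psInner n s x y := by
  rw [psB, Matrix.toBilin'_apply', psInner]

theorem psB_symm (n s : ℕ) (x y : Fin n → ℝ) : psB n s x y = psB n s y x := by
  rw [psB_apply, psB_apply, psInner, psInner, Matrix.dotProduct_mulVec, ← Matrix.mulVec_transpose,
    psJ_tr, dotProduct_comm]

theorem psB_adj {n s : ℕ} {A : Matrix (Fin n) (Fin n) ℝ} (hA : Aᵀ = psJ n s * A * psJ n s)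
    (x y : Fin n → ℝ) : psB n s (A *ᵥ x) y = psB n s x (A *ᵥ y) := by
  rw [psB_apply, psB_apply, psInner, psInner, dotProduct_comm, Matrix.dotProduct_mulVec,
    ← Matrix.mulVec_transpose, hA, dotProduct_comm, Matrix.mulVec_mulVec, Matrix.mulVec_mulVec,
    mul_assoc, psJ_sq, mul_one]

theorem exists_coord_pos (n s : ℕ) (hs : s ≤ n) :
    ∃ Q : Submodule ℝ (Fin n → ℝ), PosOn (psB n s) Q ∧ n - s ≤ Module.finrank ℝ Q := by
  let f : (Fin n → ℝ) →ₗ[ℝ] (Fin s → ℝ) :=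
    LinearMap.pi fun k => LinearMap.proj (⟨k, by omega⟩ : Fin n)
  refine ⟨f.ker, fun w hw h0 => ?_, ?_⟩
  · have hz : ∀ i : Fin n, (i : ℕ) < s → w i = 0 := fun i hi =>
      congrFun (LinearMap.mem_ker.1 hw) ⟨i, hi⟩
    have e : psB n s w w = ∑ i, w i ^ 2 := by
      rw [psB_apply, psInner, psJ, dotProduct]
      refine Finset.sum_congr rfl fun i _ => ?_
      rw [Matrix.mulVec_diagonal]
      by_cases hi : (i : ℕ) < s
      · simp [hz i hi]
      · simp [hi]; ring
    rw [e]
    obtain ⟨i, hi⟩ := Function.ne_iff.1 h0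
    have hi' : w i ≠ 0 := hi
    exact Finset.sum_pos' (fun _ _ => sq_nonneg _) ⟨i, Finset.mem_univ _, by positivity⟩
  · have h1 := LinearMap.finrank_range_add_finrank_ker f
    have h2 := Submodule.finrank_le f.range
    simp only [Module.finrank_fin_fun] at h1 h2
    omega

/-- Push a definite subspace forward by an (anti-)isometry. -/
theorem map_pos {n : ℕ} {B : LinearMap.BilinForm ℝ (Fin n → ℝ)}
    (L : (Fin n → ℝ) →ₗ[ℝ] (Fin n → ℝ)) (ε : ℝ) (hL : ∀ x, B (L x) (L x) = ε * B x x)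
    (hinj : Function.Injective L) {E F W : Submodule ℝ (Fin n → ℝ)} (hWE : W ≤ E)
    (hLE : ∀ x ∈ E, L x ∈ F) (hW : ∀ w ∈ W, w ≠ 0 → 0 < ε * B w w) :
    ∃ W' ≤ F, PosOn B W' ∧ Module.finrank ℝ W' = Module.finrank ℝ W := by
  refine ⟨W.map L, ?_, ?_, ?_⟩
  · rintro _ ⟨x, hx, rfl⟩
    exact hLE x (hWE hx)
  · rintro _ ⟨x, hx, rfl⟩ h0
    rw [hL]
    exact hW x hx (by rintro rfl; simp at h0)
  · exact (Submodule.equivMapOfInjective L hinj W).finrank_eq.symm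

theorem negIndex_bdd (n s : ℕ) (V : Submodule ℝ (Fin n → ℝ)) :
    BddAbove {d : ℕ | ∃ W : Submodule ℝ (Fin n → ℝ), W ≤ V ∧
    (∀ z ∈ W, z ≠ 0 → psInner n s z z < 0) ∧ Module.finrank ℝ ↥W = d} := by
  refine ⟨n, ?_⟩
  rintro d ⟨W, -, -, rfl⟩
  simpa using Submodule.finrank_le W

end CliffordProd

/-- with `m ≡ 0 (mod 4)`, `r ≡ 0 (mod 2)`, `s ≤ 2l - 1`,
`P = P_1 ⋯ P_m`, in the cases (d-1) `r = 0` and `s < 2(l - m)`; (d-2)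
`r ∈ {2, 4, …, m-2}`, `s = l`, and `m - r < l/2`; (d-3) `r = m`, `s = l` and the
index `s₁` of `⟨·,·⟩` restricted to `E₊(P)` satisfies `m ≤ s₁ ≤ l - m`:
`M₊` is connected and `M₊,₁`, `M₊,₂`, `M₊,₃` are all non-empty. -/
theorem Mplus_connected_cases (l s m r : ℕ) (hl : 0 < l) (hs : s ≤ 2 * l - 1)
    (hm : 2 ≤ m) (hm4 : m % 4 = 0) (hr : r ≤ m) (hr2 : r % 2 = 0)
    (P : ℕ → Matrix (Fin (2 * l)) (Fin (2 * l)) ℝ)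
    (hP : IsCliffordSystem l s m r P)
    (Pm : Matrix (Fin (2 * l)) (Fin (2 * l)) ℝ)
    (hPm : Pm = ((List.range m).map fun k => P (1 + k)).prod)
    (Mp : Set (Fin (2 * l) → ℝ))
    (hMp : Mp = {x | psInner (2 * l) s x x = 1 ∧
      ∀ j ∈ Finset.Icc 1 m, psInner (2 * l) s (P j *ᵥ x) x = 0})
    (zpl : (Fin (2 * l) → ℝ) → (Fin (2 * l) → ℝ))
    (hzpl : zpl = fun z => (1 / 2 : ℝ) • (z + Pm *ᵥ z))
    (M1 M2 M3 : Set (Fin (2 * l) → ℝ))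
    (hM1 : M1 = {z ∈ Mp | 1 ≤ psInner (2 * l) s (zpl z) (zpl z)})
    (hM2 : M2 = {z ∈ Mp | psInner (2 * l) s (zpl z) (zpl z) ≤ 0})
    (hM3 : M3 = {z ∈ Mp | 0 < psInner (2 * l) s (zpl z) (zpl z) ∧
      psInner (2 * l) s (zpl z) (zpl z) < 1})
    (hcase : (r = 0 ∧ s + 2 * m < 2 * l) ∨
      (2 ≤ r ∧ r + 2 ≤ m ∧ s = l ∧ 2 * (m - r) < l) ∨
      (r = m ∧ s = l ∧
        m ≤ negIndex (2 * l) s (Module.End.eigenspace (Matrix.toLin' Pm) 1) ∧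
        negIndex (2 * l) s (Module.End.eigenspace (Matrix.toLin' Pm) 1) + m ≤ l)) :
    IsConnected Mp ∧ M1.Nonempty ∧ M2.Nonempty ∧ M3.Nonempty := by
  set B := psB (2 * l) s with hBdef
  have hB : ∀ x y, B x y = B y x := psB_symm _ _
  have hPm' : Pm = cliffProd P m := hPm
  obtain ⟨q, hq⟩ : ∃ q, m = 4 * q := ⟨m / 4, by omega⟩
  obtain ⟨r', hr'⟩ : ∃ r', r = 2 * r' := ⟨r / 2, by omega⟩
  have hch : m.choose 2 = 2 * (q * (m - 1)) := by
    rw [Nat.choose_two_right, hq, show 4 * q * (4 * q - 1) = 2 * (2 * (q * (4 * q - 1))) by ring]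
    omega
  have hPsq : Pm * Pm = 1 := by
    rw [hPm', cliffProd_sq hP m le_rfl, hch, min_eq_right hr, hr', ← mul_add, pow_mul]
    simp
  have hPtr : Pmᵀ = psJ (2 * l) s * Pm * psJ (2 * l) s := by
    rw [hPm', cliffProd_tr hP m le_rfl, hch, pow_mul]
    simp
  have hPc : ∀ j ∈ Finset.Icc 1 m, P j * Pm = - (Pm * P j) := by
    intro j hj
    rw [hPm', cliffProd_comm_in hP hj m (Finset.mem_Icc.1 hj).2 le_rfl, hq,
      show 4 * q = 2 * (2 * q) by ring, pow_mul]
    simp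
  set L : ℕ → (Fin (2 * l) → ℝ) →ₗ[ℝ] (Fin (2 * l) → ℝ) := fun j => Matrix.toLin' (P j) with hL
  have hLa : ∀ j x, L j x = P j *ᵥ x := fun j x => Matrix.toLin'_apply _ _
  set E := Module.End.eigenspace (Matrix.toLin' Pm) 1 with hE
  set F := Module.End.eigenspace (Matrix.toLin' Pm) (-1) with hF
  have memE : ∀ x, x ∈ E ↔ Pm *ᵥ x = x := by
    intro x; rw [hE, Module.End.mem_eigenspace_iff, Matrix.toLin'_apply, one_smul]
  have memF : ∀ x, x ∈ F ↔ Pm *ᵥ x = -x := by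
    intro x; rw [hF, Module.End.mem_eigenspace_iff, Matrix.toLin'_apply, neg_smul, one_smul]
  have hEF : ∀ x ∈ E, ∀ y ∈ F, B x y = 0 := by
    intro x hx y hy
    have h := psB_adj hPtr x y
    rw [(memE x).1 hx, (memF y).1 hy, map_neg] at h
    linarith
  have hPP : ∀ x, Pm *ᵥ (Pm *ᵥ x) = x := by
    intro x; rw [Matrix.mulVec_mulVec, hPsq, Matrix.one_mulVec]
  have hdec : ∀ z, ∃ x ∈ E, ∃ y ∈ F, z = x + y := by
    intro z
    refine ⟨(1 / 2 : ℝ) • (z + Pm *ᵥ z), ?_, (1 / 2 : ℝ) • (z - Pm *ᵥ z), ?_, ?_⟩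
    · rw [memE, Matrix.mulVec_smul, Matrix.mulVec_add, hPP, add_comm]
    · rw [memF, Matrix.mulVec_smul, Matrix.mulVec_sub, hPP, ← smul_neg, neg_sub]
    · module
  have hLB : ∀ j ∈ Finset.Icc 1 m, ∀ x y, B (L j x) y = B x (L j y) := by
    intro j hj x y
    rw [hLa, hLa]
    exact psB_adj (hP.1 j hj) x y
  have hLE : ∀ j ∈ Finset.Icc 1 m, ∀ x ∈ E, L j x ∈ F := by
    intro j hj x hx
    have h : P j *ᵥ (Pm *ᵥ x) = - (Pm *ᵥ (P j *ᵥ x)) := by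
      rw [Matrix.mulVec_mulVec, Matrix.mulVec_mulVec, hPc j hj, Matrix.neg_mulVec]
    rw [(memE x).1 hx] at h
    rw [memF, hLa, h, neg_neg, ← h]
  have hLF : ∀ j ∈ Finset.Icc 1 m, ∀ x ∈ F, L j x ∈ E := by
    intro j hj x hx
    have h : P j *ᵥ (Pm *ᵥ x) = - (Pm *ᵥ (P j *ᵥ x)) := by
      rw [Matrix.mulVec_mulVec, Matrix.mulVec_mulVec, hPc j hj, Matrix.neg_mulVec]
    rw [(memF x).1 hx, Matrix.mulVec_neg] at h
    rw [memE, hLa]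
    exact (neg_injective h).symm
  have hLL : ∀ i ∈ Finset.Icc 1 m, ∀ j ∈ Finset.Icc 1 m, ∀ x,
      B (L i x) (L j x) = cliffEta r i j * B x x := by
    intro i hi j hj x
    have h1 : B (L i x) (L j x) = B x ((P i * P j) *ᵥ x) := by
      rw [hLB i hi, hLa, hLa, Matrix.mulVec_mulVec]
    have h2 : B (L i x) (L j x) = B x ((P j * P i) *ᵥ x) := by
      rw [hB, hLB j hj, hLa, hLa, Matrix.mulVec_mulVec]
    have h3 : B x ((P i * P j + P j * P i) *ᵥ x) = 2 * cliffEta r i j * B x x := by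
      rw [hP.2 i hi j hj, Matrix.smul_mulVec, Matrix.one_mulVec, map_smul, smul_eq_mul]
    rw [Matrix.add_mulVec, map_add] at h3
    linarith
  have hinj : ∀ j ∈ Finset.Icc 1 m, Function.Injective (L j) := by
    intro j hj
    rw [← LinearMap.ker_eq_bot, LinearMap.ker_eq_bot']
    intro x hx
    have h : (P j * P j) *ᵥ x = 0 := by
      rw [← Matrix.mulVec_mulVec, ← hLa j x, hx, Matrix.mulVec_zero]
    rw [cliff_sq hP hj, Matrix.smul_mulVec, Matrix.one_mulVec, smul_eq_zero] at h
    refine h.resolve_left ?_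
    simp only [cliffEta, if_true]
    split_ifs <;> norm_num
  obtain ⟨Q, hQ, hQd⟩ := exists_coord_pos (2 * l) s (by omega)
  obtain ⟨V₁, hV1, V₂, hV2, hpV1, hpV2, hVd⟩ := split_dim hB hEF hdec hQ
  have h1m : 1 ∈ Finset.Icc 1 m := by rw [Finset.mem_Icc]; omega
  have hmm : m ∈ Finset.Icc 1 m := by rw [Finset.mem_Icc]; omega
  -- the case of a last isometry
  have hiso : r < m → ∃ W₁ ≤ E, ∃ W₂ ≤ F, PosOn B W₁ ∧ PosOn B W₂ ∧
      Module.finrank ℝ W₁ = Module.finrank ℝ W₂ ∧ 2 * l - s ≤ 2 * Module.finrank ℝ W₂ := by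
    intro hrm
    have hiL : ∀ x, B (L m x) (L m x) = 1 * B x x := by
      intro x
      rw [hLL m hmm m hmm]
      simp [cliffEta, not_le.2 hrm]
    rcases le_total (Module.finrank ℝ V₁) (Module.finrank ℝ V₂) with h | h
    · obtain ⟨W, hWE, hWp, hWd⟩ := map_pos (L m) 1 hiL (hinj m hmm) hV2 (hLF m hmm)
        (by intro w hw h0; rw [one_mul]; exact hpV2 w hw h0)
      exact ⟨W, hWE, V₂, hV2, hWp, hpV2, hWd, by omega⟩
    · obtain ⟨W, hWE, hWp, hWd⟩ := map_pos (L m) 1 hiL (hinj m hmm) hV1 (hLE m hmm)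
        (by intro w hw h0; rw [one_mul]; exact hpV1 w hw h0)
      exact ⟨V₁, hV1, W, hWE, hpV1, hWp, hWd.symm, by omega⟩
  obtain ⟨W₁, h1E, W₂, h2F, hp1, hp2, hd1, hd2, hd⟩ : ∃ W₁ ≤ E, ∃ W₂ ≤ F, PosOn B W₁ ∧
      PosOn B W₂ ∧ 2 ≤ Module.finrank ℝ W₁ ∧ 2 ≤ Module.finrank ℝ W₂ ∧
      m - r < Module.finrank ℝ W₂ := by
    rcases hcase with ⟨h0, h1⟩ | ⟨h0, h1, h2, h3⟩ | ⟨h0, h1, h2, h3⟩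
    · obtain ⟨W₁, h1E, W₂, h2F, hp1, hp2, e, hd⟩ := hiso (by omega)
      exact ⟨W₁, h1E, W₂, h2F, hp1, hp2, by omega, by omega, by omega⟩
    · obtain ⟨W₁, h1E, W₂, h2F, hp1, hp2, e, hd⟩ := hiso (by omega)
      exact ⟨W₁, h1E, W₂, h2F, hp1, hp2, by omega, by omega, by omega⟩
    · have hanti : ∀ x, B (L 1 x) (L 1 x) = (-1) * B x x := by
        intro x
        rw [hLL 1 h1m 1 h1m]
        have : 1 ≤ r := by omega
        simp [cliffEta, this]
      have hsup := Nat.sSup_mem (s := {d : ℕ | ∃ W : Submodule ℝ (Fin (2 * l) → ℝ), W ≤ E ∧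
        (∀ z ∈ W, z ≠ 0 → psInner (2 * l) s z z < 0) ∧ Module.finrank ℝ ↥W = d})
        ⟨0, ⊥, bot_le, fun z hz h => absurd (by simpa using hz) h, by simp⟩
        (negIndex_bdd _ _ E)
      obtain ⟨N, hNE, hN, hNd⟩ := hsup
      have hNd' : Module.finrank ℝ N = negIndex (2 * l) s E := hNd
      obtain ⟨W₂, hW2, hW2p, hW2d⟩ := map_pos (L 1) (-1) hanti (hinj 1 h1m) hNE (hLE 1 h1m)
        (by
          intro w hw h0
          have := hN w hw h0
          rw [hBdef, psB_apply]; linarith)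
      -- image of `V₂` is negative definite in `E`
      have hle : Module.finrank ℝ V₂ ≤ negIndex (2 * l) s E := by
        apply le_csSup (negIndex_bdd _ _ E)
        refine ⟨V₂.map (L 1), ?_, ?_, ?_⟩
        · rintro _ ⟨x, hx, rfl⟩
          exact hLF 1 h1m x (hV2 hx)
        · rintro _ ⟨x, hx, rfl⟩ hx0
          rw [← psB_apply, ← hBdef, hanti]
          have := hpV2 x hx (by rintro rfl; simp at hx0)
          linarith
        · exact (Submodule.equivMapOfInjective (L 1) (hinj 1 h1m) V₂).finrank_eq.symm
      exact ⟨V₁, hV1, W₂, hW2, hpV1, hW2p, by omega, by omega, by omega⟩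
  obtain ⟨hconn, x, hx, y, hy, hx1, hy1, hxM, hyM, hzM⟩ := core_thm hB m r hr L hEF hdec hLB hLE
    hLF hLL h1E h2F hp1 hp2 hd1 hd2 hd Mp (by
      rw [hMp]
      simp only [hLa, hBdef, psB_apply])
  have hx' := (memE x).1 hx
  have hy' := (memF y).1 hy
  refine ⟨hconn, ⟨x, ?_⟩, ⟨y, ?_⟩,
    ⟨(Real.sqrt 2)⁻¹ • x + (Real.sqrt 2)⁻¹ • y, ?_⟩⟩
  · rw [hM1]
    refine ⟨hxM, ?_⟩
    have e : zpl x = x := by rw [hzpl]; simp only [hx']; module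
    rw [e, ← psB_apply, ← hBdef, hx1]
  · rw [hM2]
    refine ⟨hyM, ?_⟩
    have e : zpl y = 0 := by rw [hzpl]; simp only [hy']; module
    rw [e, ← psB_apply, map_zero]
  · rw [hM3]
    refine ⟨hzM, ?_⟩
    have e : zpl ((Real.sqrt 2)⁻¹ • x + (Real.sqrt 2)⁻¹ • y) = (Real.sqrt 2)⁻¹ • x := by
      rw [hzpl]
      simp only [Matrix.mulVec_add, Matrix.mulVec_smul, hx', hy']
      module
    have hs2' : ((Real.sqrt 2)⁻¹ : ℝ) ^ 2 = 1 / 2 := by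
      rw [inv_pow, Real.sq_sqrt (by norm_num)]; norm_num
    have e2 : B ((Real.sqrt 2)⁻¹ • x) ((Real.sqrt 2)⁻¹ • x) = 1 / 2 := by
      simp only [map_smul, LinearMap.smul_apply, smul_eq_mul, hx1]
      rw [← hs2']; ring
    rw [e, ← psB_apply, ← hBdef, e2]
    norm_num
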